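/- Fix 0 < q < 1 and integers N ≥ 2, 1 ≤ n ≤ N-1. For 0 < α < q^{-1} and 0 < β < q^{-1}, the q-Hahn polynomial H_n^{(α,β)}(·;q) has n distinct real zeros x_1(α,β) < ⋯ < x_n(α,β), and for each j ∈ {1,...,n} the zero x_j(α,β) is a strictly decreasing function of α on (0, q^{-1}) and a strictly increasing function of β on (0, q^{-1}). -/

import Mathlib

/-- q-Pochhammer symbol `(a;q)_k = ∏_{j=0}^{k-1} (1 - a q^j)`. -/
noncomputable def qpoch (q a : ℝ) (k : ℕ) : ℝ := ∏ j ∈ Finset.range k, (1 - a * q ^ j)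

/-- q-Hahn polynomial `H_n^{(α,β)}(x;q)`. -/
noncomputable def qHahnPoly (q : ℝ) (N n : ℕ) (α β x : ℝ) : ℝ :=
  ∑ k ∈ Finset.range (n + 1),
    qpoch q (q ^ (-(n : ℤ))) k * qpoch q (α * β * q ^ (n + 1)) k * qpoch q x k /
      (qpoch q (α * q) k * qpoch q (q ^ ((1 : ℤ) - (N : ℤ))) k * qpoch q q k) * q ^ k

open Polynomial

/-- The functional `f ↦ ∑ s ∈ S, w s * f (y s)` attached to a discrete measure with nodes `y s` and
weights `w s`. -/
noncomputable def discreteIntegral {ι : Type*} (S : Finset ι) (y w : ι → ℝ) : ℝ[X] →ₗ[ℝ] ℝ :=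
  ∑ s ∈ S, w s • leval (y s)

theorem discreteIntegral_apply {ι : Type*} (S : Finset ι) (y w : ι → ℝ) (f : ℝ[X]) :
    discreteIntegral S y w f = ∑ s ∈ S, w s * f.eval (y s) := by
  simp [discreteIntegral]

theorem eval_node_eq_zero_of_discreteIntegral_eq_zero {ι : Type*} {S : Finset ι} {y w : ι → ℝ}
    (hw : ∀ s ∈ S, 0 < w s) {f : ℝ[X]} (hf : ∀ t, 0 ≤ f.eval t)
    (h0 : discreteIntegral S y w f = 0) : ∀ s ∈ S, f.eval (y s) = 0 := by
  rw [discreteIntegral_apply,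
    Finset.sum_eq_zero_iff_of_nonneg fun s hs => mul_nonneg (hw s hs).le (hf _)] at h0
  intro s hs
  simpa [(hw s hs).ne'] using h0 s hs

/-- `p` has degree `n` and is orthogonal to all polynomials of smaller degree. -/
def IsOrthogonalPoly {ι : Type*} (S : Finset ι) (y w : ι → ℝ) (n : ℕ) (p : ℝ[X]) : Prop :=
  p.degree = n ∧ ∀ f : ℝ[X], f.degree < n → discreteIntegral S y w (p * f) = 0

/-- A nonnegative quadratic polynomial does not divide an orthogonal polynomial. -/
theorem IsOrthogonalPoly.not_quadratic_dvd {ι : Type*} {S : Finset ι} {y w : ι → ℝ} {n : ℕ}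
    {p : ℝ[X]} (hp : IsOrthogonalPoly S y w n p) (hy : Set.InjOn y S) (hw : ∀ s ∈ S, 0 < w s)
    (hn : n < S.card) {Q : ℝ[X]} (hQ : Q.degree = 2) (hQ0 : ∀ t, 0 ≤ Q.eval t) : ¬ Q ∣ p := by
  rintro ⟨r, rfl⟩
  have hp0 : Q * r ≠ 0 := by
    intro h
    have := hp.1
    simp [h] at this
  have hr0 : r ≠ 0 := right_ne_zero_of_mul hp0
  have hdeg := hp.1
  rw [degree_mul, hQ, degree_eq_natDegree hr0] at hdeg
  have hdeg' : 2 + r.natDegree = n := by exact_mod_cast hdeg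
  have h0 := hp.2 r (by rw [degree_eq_natDegree hr0]; exact_mod_cast (by omega))
  have hz := eval_node_eq_zero_of_discreteIntegral_eq_zero hw
    (fun t => by
      rw [eval_mul, eval_mul, mul_assoc]
      exact mul_nonneg (hQ0 t) (mul_self_nonneg _)) h0
  refine hp0 (Polynomial.eq_zero_of_degree_lt_of_eval_index_eq_zero S hy ?_ ?_)
  · rw [hp.1]; exact_mod_cast hn
  · intro s hs
    have := hz s hs
    rw [eval_mul] at this
    rcases mul_eq_zero.1 this with h | h
    · exact h
    · rw [eval_mul, h, mul_zero]

theorem IsOrthogonalPoly.splits {ι : Type*} {S : Finset ι} {y w : ι → ℝ} {n : ℕ} {p : ℝ[X]}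
    (hp : IsOrthogonalPoly S y w n p) (hy : Set.InjOn y S) (hw : ∀ s ∈ S, 0 < w s)
    (hn : n < S.card) : p.Splits := by
  refine Splits.of_splits_map (algebraMap ℝ ℂ) (IsAlgClosed.splits _) fun z hz => ?_
  replace hz : aeval z p = 0 := by
    simpa only [IsRoot.def, eval_map_algebraMap] using isRoot_of_mem_roots hz
  by_cases him : z.im = 0
  · exact ⟨z.re, by simp [Complex.ext_iff, him]⟩
  · refine absurd (p.quadratic_dvd_of_aeval_eq_zero_im_ne_zero hz him)
      (hp.not_quadratic_dvd hy hw hn ?_ fun t => ?_)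
    · compute_degree!
    · have hnorm : ‖z‖ ^ 2 = z.re ^ 2 + z.im ^ 2 := by
        rw [Complex.sq_norm, Complex.normSq_apply]; ring
      simp only [eval_add, eval_sub, eval_mul, eval_pow, eval_X, eval_C, hnorm]
      nlinarith [sq_nonneg (t - z.re), sq_nonneg z.im]

theorem IsOrthogonalPoly.nodup_roots {ι : Type*} {S : Finset ι} {y w : ι → ℝ} {n : ℕ} {p : ℝ[X]}
    (hp : IsOrthogonalPoly S y w n p) (hy : Set.InjOn y S) (hw : ∀ s ∈ S, 0 < w s)
    (hn : n < S.card) : p.roots.Nodup := by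
  classical
  refine Multiset.nodup_iff_count_le_one.2 fun a => ?_
  by_contra! h
  rw [count_roots] at h
  refine hp.not_quadratic_dvd hy hw hn (Q := (X - C a) ^ 2) ?_ (fun t => ?_)
    ((pow_dvd_pow _ h).trans (pow_rootMultiplicity_dvd p a))
  · rw [degree_pow, degree_X_sub_C]; rfl
  · simp only [eval_pow]; positivity

/-- The zeros of an orthogonal polynomial are real and simple. -/
theorem IsOrthogonalPoly.exists_strictMono_nodal {ι : Type*} {S : Finset ι} {y w : ι → ℝ} {n : ℕ}
    {p : ℝ[X]} (hp : IsOrthogonalPoly S y w n p) (hy : Set.InjOn y S) (hw : ∀ s ∈ S, 0 < w s)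
    (hn : n < S.card) :
    ∃ x : Fin n → ℝ, StrictMono x ∧ (∀ t, p.eval t = 0 ↔ ∃ j, t = x j) ∧
      p = C p.leadingCoeff * Lagrange.nodal Finset.univ x := by
  classical
  have hp0 : p ≠ 0 := by
    rintro rfl
    simpa using hp.1
  have hsp := hp.splits hy hw hn
  have hnd := hp.nodup_roots hy hw hn
  have hcard : p.roots.toFinset.card = n := by
    rw [Multiset.toFinset_card_of_nodup hnd, ← hsp.natDegree_eq_card_roots]
    exact natDegree_eq_of_degree_eq_some hp.1
  refine ⟨p.roots.toFinset.orderEmbOfFin hcard, OrderEmbedding.strictMono _, fun t => ?_, ?_⟩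
  · have := Set.ext_iff.1 (p.roots.toFinset.range_orderEmbOfFin hcard) t
    simp only [Set.mem_range, Finset.mem_coe, Multiset.mem_toFinset, mem_roots hp0] at this
    rw [← IsRoot.def, ← this]
    simp only [eq_comm]
  · conv_lhs => rw [hsp.eq_prod_roots]
    congr 1
    rw [Lagrange.nodal_eq]
    have himg : Finset.univ.image (p.roots.toFinset.orderEmbOfFin hcard) = p.roots.toFinset := by
      rw [← Finset.coe_inj]
      simp
    rw [← Finset.prod_image (s := Finset.univ) (g := p.roots.toFinset.orderEmbOfFin hcard)
      (f := fun a => X - C a) (fun _ _ _ _ h => (RelEmbedding.injective _) h), himg,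
      Finset.prod_multiset_map_count]
    refine Finset.prod_congr rfl fun a ha => ?_
    rw [Multiset.count_eq_one_of_mem hnd (Multiset.mem_toFinset.1 ha), pow_one]

theorem IsOrthogonalPoly.nodal {ι : Type*} {S : Finset ι} {y w : ι → ℝ} {n : ℕ} {p : ℝ[X]}
    (hp : IsOrthogonalPoly S y w n p) {x : Fin n → ℝ}
    (hx : p = C p.leadingCoeff * Lagrange.nodal Finset.univ x) :
    IsOrthogonalPoly S y w n (Lagrange.nodal Finset.univ x) := by
  have hp0 : p ≠ 0 := by
    rintro rfl
    simpa using hp.1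
  refine ⟨by simp, fun f hf => ?_⟩
  have h := hp.2 f hf
  rw [hx, mul_assoc, ← smul_eq_C_mul, map_smul, smul_eq_mul] at h
  exact (mul_eq_zero.1 h).resolve_left (by simpa using hp0)

/-- Gauss quadrature. -/
theorem IsOrthogonalPoly.discreteIntegral_eq_sum {ι : Type*} {S : Finset ι} {y w : ι → ℝ} {n : ℕ}
    {x : Fin n → ℝ} (hp : IsOrthogonalPoly S y w n (Lagrange.nodal Finset.univ x))
    (hx : Function.Injective x) {f : ℝ[X]} (hf : f.natDegree < 2 * n) :
    discreteIntegral S y w f =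
      ∑ k, f.eval (x k) * discreteIntegral S y w (Lagrange.basis Finset.univ x k) := by
  set P := Lagrange.nodal Finset.univ x with hP
  have hPm : P.Monic := Lagrange.nodal_monic
  have hPd : P.natDegree = n := by simp [hP, Lagrange.natDegree_nodal]
  have hr : f %ₘ P = Lagrange.interpolate Finset.univ x fun k => f.eval (x k) := by
    refine Lagrange.eq_interpolate_of_eval_eq _ hx.injOn ?_ fun k _ => ?_
    · simpa [hp.1] using degree_modByMonic_lt f hPm
    · conv_rhs => rw [← modByMonic_add_div f P]
      rw [eval_add, eval_mul, Lagrange.eval_nodal_at_node (Finset.mem_univ k), zero_mul, add_zero]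
  have hq : (f /ₘ P).degree < n := by
    have hn : 0 < n := by omega
    refine lt_of_le_of_lt degree_le_natDegree ?_
    rw [natDegree_divByMonic f hPm, hPd]
    exact_mod_cast (by omega)
  conv_lhs => rw [← modByMonic_add_div f P]
  rw [map_add, hp.2 _ hq, add_zero, hr, Lagrange.interpolate_apply, map_sum]
  simp only [← smul_eq_C_mul, map_smul, smul_eq_mul]

theorem IsOrthogonalPoly.discreteIntegral_basis_nonneg {ι : Type*} {S : Finset ι} {y w : ι → ℝ}
    {n : ℕ} {x : Fin n → ℝ} (hp : IsOrthogonalPoly S y w n (Lagrange.nodal Finset.univ x))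
    (hx : Function.Injective x) (hw : ∀ s ∈ S, 0 < w s) (k : Fin n) :
    0 ≤ discreteIntegral S y w (Lagrange.basis Finset.univ x k) := by
  have hk := k.pos
  have h := hp.discreteIntegral_eq_sum hx (f := Lagrange.basis Finset.univ x k ^ 2) (by
    rw [natDegree_pow, Lagrange.natDegree_basis hx.injOn (Finset.mem_univ k), Finset.card_fin]
    omega)
  rw [Finset.sum_eq_single k (fun j _ hj => by
    rw [eval_pow, Lagrange.eval_basis_of_ne hj.symm (Finset.mem_univ j)]; simp) (by simp),
    eval_pow, Lagrange.eval_basis_self hx.injOn (Finset.mem_univ k), one_pow, one_mul] at h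
  rw [← h, discreteIntegral_apply]
  exact Finset.sum_nonneg fun s hs => mul_nonneg (hw s hs).le (by rw [eval_pow]; positivity)

theorem IsOrthogonalPoly.discreteIntegral_nonneg {ι : Type*} {S : Finset ι} {y w : ι → ℝ}
    {n : ℕ} {x : Fin n → ℝ} (hp : IsOrthogonalPoly S y w n (Lagrange.nodal Finset.univ x))
    (hx : Function.Injective x) (hw : ∀ s ∈ S, 0 < w s) {f : ℝ[X]} (hf : f.natDegree < 2 * n)
    (h0 : ∀ k, 0 ≤ f.eval (x k)) : 0 ≤ discreteIntegral S y w f := by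
  rw [hp.discreteIntegral_eq_sum hx hf]
  exact Finset.sum_nonneg fun k _ => mul_nonneg (h0 k) (hp.discreteIntegral_basis_nonneg hx hw k)

/-- Strict Chebyshev correlation inequality for two weights with increasing ratio. -/
theorem sum_mul_sum_lt_of_ratio_lt {ι : Type*} [LinearOrder ι] {S : Finset ι} {y v w a : ι → ℝ}
    (hy : StrictMonoOn y S)
    (hvw : ∀ s ∈ S, ∀ t ∈ S, s < t → w s * v t < w t * v s)
    (ha : ∀ s ∈ S, 0 ≤ a s) {s₀ t₀ : ι} (hs₀ : s₀ ∈ S) (ht₀ : t₀ ∈ S) (hne : s₀ ≠ t₀)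
    (has : 0 < a s₀) (hat : 0 < a t₀) :
    (∑ s ∈ S, v s * (y s * a s)) * ∑ s ∈ S, w s * a s <
      (∑ s ∈ S, w s * (y s * a s)) * ∑ s ∈ S, v s * a s := by
  have hpos : ∀ s ∈ S, ∀ t ∈ S, s ≠ t → 0 < (y s - y t) * (w s * v t - w t * v s) := by
    intro s hs t ht hst
    rcases lt_or_gt_of_ne hst with h | h
    · exact mul_pos_of_neg_of_neg (sub_neg.2 (hy hs ht h)) (sub_neg.2 (hvw s hs t ht h))
    · exact mul_pos (sub_pos.2 (hy ht hs h)) (sub_pos.2 (hvw t ht s hs h))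
  have hnn : ∀ s ∈ S, ∀ t ∈ S, 0 ≤ a s * a t * ((y s - y t) * (w s * v t - w t * v s)) := by
    intro s hs t ht
    refine mul_nonneg (mul_nonneg (ha s hs) (ha t ht)) ?_
    rcases eq_or_ne s t with rfl | h
    · simp
    · exact (hpos s hs t ht h).le
  have hsum : 0 < ∑ s ∈ S, ∑ t ∈ S, a s * a t * ((y s - y t) * (w s * v t - w t * v s)) :=
    Finset.sum_pos' (fun s hs => Finset.sum_nonneg (hnn s hs)) ⟨s₀, hs₀,
      Finset.sum_pos' (hnn s₀ hs₀)
        ⟨t₀, ht₀, mul_pos (mul_pos has hat) (hpos s₀ hs₀ t₀ ht₀ hne)⟩⟩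
  have hexp : ∑ s ∈ S, ∑ t ∈ S, a s * a t * ((y s - y t) * (w s * v t - w t * v s)) =
      2 * ((∑ s ∈ S, w s * (y s * a s)) * (∑ s ∈ S, v s * a s) -
        (∑ s ∈ S, v s * (y s * a s)) * ∑ s ∈ S, w s * a s) := by
    have e1 : ∀ s t, a s * a t * ((y s - y t) * (w s * v t - w t * v s)) =
        ((w s * (y s * a s)) * (v t * a t) - (v s * (y s * a s)) * (w t * a t)) +
          ((v s * a s) * (w t * (y t * a t)) - (w s * a s) * (v t * (y t * a t))) := by
      intro s t; ring
    simp only [e1, Finset.sum_add_distrib, Finset.sum_sub_distrib, ← Finset.sum_mul_sum]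
    ring
  linarith

/-- Markov's theorem on the monotonicity of zeros: if the ratio `w / v` of two positive weights
increases along the nodes, then so do the zeros of the orthogonal polynomials. -/
theorem IsOrthogonalPoly.zero_lt_zero {ι : Type*} [LinearOrder ι] {S : Finset ι} {y v w : ι → ℝ}
    {n : ℕ} {x z : Fin n → ℝ} (hx : StrictMono x) (hz : StrictMono z)
    (hxp : IsOrthogonalPoly S y v n (Lagrange.nodal Finset.univ x))
    (hzp : IsOrthogonalPoly S y w n (Lagrange.nodal Finset.univ z))
    (hy : StrictMonoOn y S) (hn : n < S.card)
    (hv : ∀ s ∈ S, 0 < v s) (hw : ∀ s ∈ S, 0 < w s)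
    (hvw : ∀ s ∈ S, ∀ t ∈ S, s < t → w s * v t < w t * v s) (j : Fin n) : x j < z j := by
  classical
  set u : ℝ[X] := Lagrange.nodal (Finset.univ.erase j) (fun i => if i < j then x i else z i) with hu
  have hu0 : u ≠ 0 := Lagrange.nodal_ne_zero
  have hud : u.natDegree = n - 1 := by simp [hu, Lagrange.natDegree_nodal]
  have hux : ∀ k < j, u.eval (x k) = 0 := fun k hk => by
    have := Lagrange.eval_nodal_at_node (s := Finset.univ.erase j)
      (v := fun i => if i < j then x i else z i) (i := k) (by simp [hk.ne])
    simpa [hk] using this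
  have huz : ∀ k, j < k → u.eval (z k) = 0 := fun k hk => by
    have := Lagrange.eval_nodal_at_node (s := Finset.univ.erase j)
      (v := fun i => if i < j then x i else z i) (i := k) (by simp [hk.ne'])
    simpa [hk.not_gt] using this
  have hj := j.pos
  have hdeg : ∀ c : ℝ, ((X - C c) * u ^ 2).natDegree < 2 * n := fun c => by
    rw [natDegree_mul (X_sub_C_ne_zero c) (pow_ne_zero 2 hu0), natDegree_pow, natDegree_X_sub_C,
      hud]
    omega
  have h1 : 0 ≤ discreteIntegral S y v ((X - C (x j)) * u ^ 2) := by
    refine hxp.discreteIntegral_nonneg hx.injective hv (hdeg _) fun k => ?_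
    rcases lt_or_ge k j with hk | hk
    · simp [hux k hk]
    · simp only [eval_mul, eval_sub, eval_X, eval_C, eval_pow]
      exact mul_nonneg (sub_nonneg.2 (hx.monotone hk)) (sq_nonneg _)
  have h2 : 0 ≤ discreteIntegral S y w (-((X - C (z j)) * u ^ 2)) := by
    refine hzp.discreteIntegral_nonneg hz.injective hw (by rw [natDegree_neg]; exact hdeg _)
      fun k => ?_
    rcases lt_or_ge j k with hk | hk
    · simp [huz k hk]
    · simp only [eval_neg, eval_mul, eval_sub, eval_X, eval_C, eval_pow]
      have := mul_nonneg (sub_nonneg.2 (hz.monotone hk)) (sq_nonneg (u.eval (z k)))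
      linarith
  set T := S.filter fun s => ¬ u.eval (y s) = 0 with hT
  have hTcard : 1 < T.card := by
    have hU : (S.filter fun s => u.eval (y s) = 0).card ≤ n - 1 := by
      rw [← hud, ← Finset.card_image_of_injOn
        (hy.injOn.mono (Finset.coe_subset.2 (Finset.filter_subset _ _)))]
      refine card_le_degree_of_subset_roots fun t ht => ?_
      obtain ⟨s, hs, rfl⟩ := Finset.mem_image.1 (Finset.mem_def.2 ht)
      exact (mem_roots hu0).2 (Finset.mem_filter.1 hs).2
    have : (S.filter fun s => u.eval (y s) = 0).card + T.card = S.card := by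
      convert! Finset.card_filter_add_card_filter_not (s := S) (fun s => u.eval (y s) = 0)
    omega
  obtain ⟨s₀, hs₀, t₀, ht₀, hne⟩ := Finset.one_lt_card.1 hTcard
  rw [hT, Finset.mem_filter] at hs₀ ht₀
  have hpos : ∀ r : ι → ℝ, (∀ s ∈ S, 0 < r s) → 0 < ∑ s ∈ S, r s * u.eval (y s) ^ 2 := fun r hr =>
    Finset.sum_pos' (fun s hs => mul_nonneg (hr s hs).le (sq_nonneg _))
      ⟨s₀, hs₀.1, mul_pos (hr _ hs₀.1) (by have := hs₀.2; positivity)⟩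
  have hch := sum_mul_sum_lt_of_ratio_lt (a := fun s => u.eval (y s) ^ 2) hy hvw
    (fun s _ => sq_nonneg _) hs₀.1 ht₀.1 hne (by have := hs₀.2; positivity)
    (by have := ht₀.2; positivity)
  have hexp : ∀ (r : ι → ℝ) (c : ℝ), discreteIntegral S y r ((X - C c) * u ^ 2) =
      ∑ s ∈ S, r s * (y s * u.eval (y s) ^ 2) - c * ∑ s ∈ S, r s * u.eval (y s) ^ 2 := by
    intro r c
    rw [discreteIntegral_apply, Finset.mul_sum, ← Finset.sum_sub_distrib]
    refine Finset.sum_congr rfl fun s _ => ?_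
    simp only [eval_mul, eval_sub, eval_X, eval_C, eval_pow]
    ring
  rw [hexp] at h1
  rw [map_neg, hexp] at h2
  have hV := hpos v hv
  have hW := hpos w hw
  nlinarith [mul_nonneg h1 hW.le, mul_nonneg h2 hV.le, mul_pos hV hW]

theorem qpoch_zero (q a : ℝ) : qpoch q a 0 = 1 := by simp [qpoch]

theorem qpoch_succ (q a : ℝ) (k : ℕ) : qpoch q a (k + 1) = qpoch q a k * (1 - a * q ^ k) := by
  simp [qpoch, Finset.prod_range_succ]

theorem qpoch_succ' (q a : ℝ) (k : ℕ) : qpoch q a (k + 1) = (1 - a) * qpoch q (q * a) k := by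
  simp only [qpoch, Finset.prod_range_succ', pow_zero, mul_one]
  rw [mul_comm]
  congr 1
  exact Finset.prod_congr rfl fun j _ => by ring

theorem qpoch_pos {q a : ℝ} (hq0 : 0 ≤ q) (hq1 : q ≤ 1) (ha0 : 0 ≤ a) (ha1 : a < 1) (k : ℕ) :
    0 < qpoch q a k :=
  Finset.prod_pos fun j _ => by
    have := mul_le_of_le_one_right ha0 (pow_le_one₀ hq0 hq1 (n := j))
    linarith

theorem one_sub_zpow_neg_mul_pow_ne_zero {q : ℝ} (hq0 : 0 < q) (hq1 : q < 1) {M j : ℕ}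
    (hj : j < M) : 1 - q ^ (-(M : ℤ)) * q ^ j ≠ 0 := by
  rw [zpow_neg, zpow_natCast, sub_ne_zero]
  intro h
  have hM : q ^ M ≠ 0 := (pow_pos hq0 M).ne'
  field_simp at h
  exact (pow_lt_pow_right_of_lt_one₀ hq0 hq1 hj).ne h

theorem qpoch_zpow_neg_ne_zero {q : ℝ} (hq0 : 0 < q) (hq1 : q < 1) {M k : ℕ} (hk : k ≤ M) :
    qpoch q (q ^ (-(M : ℤ))) k ≠ 0 :=
  Finset.prod_ne_zero_iff.2 fun _ hj =>
    one_sub_zpow_neg_mul_pow_ne_zero hq0 hq1 ((Finset.mem_range.1 hj).trans_le hk)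

/-- The coefficient of `(x;q)_k` in the `q`-Hahn polynomial of degree `n` on `M + 1` nodes. -/
noncomputable def qHahnCoeff (q : ℝ) (M n : ℕ) (α β : ℝ) (k : ℕ) : ℝ :=
  qpoch q (q ^ (-(n : ℤ))) k * qpoch q (α * β * q ^ (n + 1)) k /
    (qpoch q (α * q) k * qpoch q (q ^ (-(M : ℤ))) k * qpoch q q k) * q ^ k

theorem qHahnPoly_eq_sum (q : ℝ) (M n : ℕ) (α β x : ℝ) :
    qHahnPoly q (M + 1) n α β x =
      ∑ k ∈ Finset.range (n + 1), qHahnCoeff q M n α β k * qpoch q x k := by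
  have hM : (1 : ℤ) - ((M + 1 : ℕ) : ℤ) = -(M : ℤ) := by push_cast; ring
  unfold qHahnPoly qHahnCoeff
  rw [hM]
  exact Finset.sum_congr rfl fun k _ => by ring

/-- The `q`-difference operator diagonalised by the `q`-Hahn polynomials. -/
noncomputable def qHahnOp (q : ℝ) (M : ℕ) (α β : ℝ) (F : ℝ → ℝ) (x : ℝ) : ℝ :=
  (1 - q ^ (-(M : ℤ)) / x) * (1 - α * q / x) * (F (q⁻¹ * x) - F x) -
    α * q * (1 - 1 / x) * (β - q ^ (-(M : ℤ)) / (q * x)) * (F x - F (q * x))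

/-- The eigenvalues of `qHahnOp`. -/
noncomputable def qHahnEigenvalue (q α β : ℝ) (k : ℕ) : ℝ := (1 - q ^ k) * (1 / q ^ k - α * β * q)

theorem qHahnOp_sum (q : ℝ) (M : ℕ) (α β : ℝ) {ι : Type*} (s : Finset ι) (c : ι → ℝ)
    (F : ι → ℝ → ℝ) (x : ℝ) :
    qHahnOp q M α β (fun t => ∑ i ∈ s, c i * F i t) x =
      ∑ i ∈ s, c i * qHahnOp q M α β (F i) x := by
  simp only [qHahnOp, ← Finset.sum_sub_distrib, Finset.mul_sum]
  exact Finset.sum_congr rfl fun i _ => by ring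

theorem qHahnOp_qpoch_zero (q : ℝ) (M : ℕ) (α β x : ℝ) :
    qHahnOp q M α β (fun t => qpoch q t 0) x = 0 := by
  simp [qHahnOp, qpoch_zero]

/-- `qHahnOp` is bidiagonal in the basis of `q`-shifted factorials. -/
theorem qHahnOp_qpoch_succ {q : ℝ} (hq : q ≠ 0) (M : ℕ) (α β : ℝ) {x : ℝ} (hx : x ≠ 0) (k : ℕ) :
    qHahnOp q M α β (fun t => qpoch q t (k + 1)) x =
      qHahnEigenvalue q α β (k + 1) * qpoch q x (k + 1) -
        (1 - q * q ^ k) * (1 - q ^ (-(M : ℤ)) * q ^ k) * (1 - α * q * q ^ k) / (q * q ^ k) *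
          qpoch q x k := by
  set K := q ^ (-(M : ℤ))
  have h1 : qpoch q (q⁻¹ * x) (k + 1) = (1 - q⁻¹ * x) * qpoch q x k := by
    rw [qpoch_succ', mul_inv_cancel_left₀ hq]
  have h2 : (1 - x) * qpoch q (q * x) (k + 1) =
      qpoch q x k * (1 - x * q ^ k) * (1 - x * q ^ (k + 1)) := by
    rw [← qpoch_succ', qpoch_succ, qpoch_succ]
  have h3 : (1 - 1 / x) * (qpoch q x (k + 1) - qpoch q (q * x) (k + 1)) =
      (qpoch q x k * (1 - x * q ^ k) * (1 - q ^ (k + 1))) := by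
    rw [qpoch_succ q x]
    generalize qpoch q (q * x) (k + 1) = Y at h2 ⊢
    field_simp
    linear_combination h2
  have h4 : α * q * (1 - 1 / x) * (β - K / (q * x)) *
      (qpoch q x (k + 1) - qpoch q (q * x) (k + 1)) = α * q * (β - K / (q * x)) *
      (qpoch q x k * (1 - x * q ^ k) * (1 - q ^ (k + 1))) := by
    rw [← h3]; ring
  have hk : q ^ k ≠ 0 := pow_ne_zero k hq
  simp only [qHahnOp, qHahnEigenvalue]
  rw [h4, h1, qpoch_succ]
  field_simp
  ring

theorem qHahnCoeff_succ_mul {q : ℝ} (hq0 : 0 < q) (hq1 : q < 1) {M n k : ℕ} (hkM : k < M)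
    {α : ℝ} (hα : 0 ≤ α) (hα1 : α * q < 1) (β : ℝ) :
    qHahnCoeff q M n α β (k + 1) *
        ((1 - q * q ^ k) * (1 - q ^ (-(M : ℤ)) * q ^ k) * (1 - α * q * q ^ k) / (q * q ^ k)) =
      (qHahnEigenvalue q α β k - qHahnEigenvalue q α β n) * qHahnCoeff q M n α β k := by
  have hαq : 0 ≤ α * q := by positivity
  have a1 := (qpoch_pos hq0.le hq1.le hαq hα1 k).ne'
  have a2 := (qpoch_pos hq0.le hq1.le hαq hα1 (k + 1)).ne'
  have b1 := (qpoch_pos hq0.le hq1.le hq0.le hq1 k).ne'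
  have b2 := (qpoch_pos hq0.le hq1.le hq0.le hq1 (k + 1)).ne'
  have c1 := qpoch_zpow_neg_ne_zero hq0 hq1 hkM.le
  have c2 := one_sub_zpow_neg_mul_pow_ne_zero hq0 hq1 hkM
  rw [qpoch_succ] at a2 b2
  replace a2 := right_ne_zero_of_mul a2
  replace b2 := right_ne_zero_of_mul b2
  have hn : q ^ (-(n : ℤ)) = 1 / q ^ n := by simp
  simp only [qHahnCoeff, qHahnEigenvalue, qpoch_succ, hn, pow_succ]
  have hqn : q ^ n ≠ 0 := (pow_pos hq0 n).ne'
  have hqk : q ^ k ≠ 0 := (pow_pos hq0 k).ne'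
  generalize 1 - q ^ (-(M : ℤ)) * q ^ k = u₁ at *
  generalize 1 - α * q * q ^ k = u₂ at *
  generalize 1 - q * q ^ k = u₃ at *
  generalize qpoch q (q ^ (-(M : ℤ))) k = v₁ at *
  generalize qpoch q (α * q) k = v₂ at *
  generalize qpoch q q k = v₃ at *
  generalize qpoch q (1 / q ^ n) k = v₄ at *
  generalize qpoch q (α * β * (q ^ n * q)) k = v₅ at *
  field_simp
  ring

theorem qHahnOp_qHahnPoly {q : ℝ} (hq0 : 0 < q) (hq1 : q < 1) {M n : ℕ} (hnM : n ≤ M)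
    {α : ℝ} (hα : 0 ≤ α) (hα1 : α * q < 1) (β : ℝ) {x : ℝ} (hx : x ≠ 0) :
    qHahnOp q M α β (qHahnPoly q (M + 1) n α β) x =
      qHahnEigenvalue q α β n * qHahnPoly q (M + 1) n α β x := by
  have hfun : qHahnPoly q (M + 1) n α β =
      fun t => ∑ k ∈ Finset.range (n + 1), qHahnCoeff q M n α β k * qpoch q t k :=
    funext (qHahnPoly_eq_sum q M n α β)
  rw [hfun, qHahnOp_sum q M α β _ _ (fun k t => qpoch q t k), Finset.sum_range_succ',
    qHahnOp_qpoch_zero, mul_zero, add_zero]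
  have hlam0 : qHahnEigenvalue q α β 0 = 0 := by simp [qHahnEigenvalue]
  have h1 : ∀ k ∈ Finset.range n,
      qHahnCoeff q M n α β (k + 1) * qHahnOp q M α β (fun t => qpoch q t (k + 1)) x =
        qHahnEigenvalue q α β (k + 1) * (qHahnCoeff q M n α β (k + 1) * qpoch q x (k + 1)) -
        (qHahnEigenvalue q α β k - qHahnEigenvalue q α β n) *
          (qHahnCoeff q M n α β k * qpoch q x k) := fun k hk => by
    rw [qHahnOp_qpoch_succ hq0.ne' M α β hx, ← mul_assoc (_ - _),
      ← qHahnCoeff_succ_mul hq0 hq1 ((Finset.mem_range.1 hk).trans_le hnM) hα hα1]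
    ring
  rw [Finset.sum_congr rfl h1, Finset.sum_sub_distrib]
  have h2 := Finset.sum_range_succ' (fun k => qHahnEigenvalue q α β k *
    (qHahnCoeff q M n α β k * qpoch q x k)) n
  rw [Finset.sum_range_succ, hlam0, zero_mul, add_zero] at h2
  beta_reduce
  rw [← h2, Finset.sum_range_succ, mul_add, Finset.mul_sum]
  simp only [sub_mul, Finset.sum_sub_distrib]
  ring

/-- The weight of the `q`-Hahn polynomials at the node `q⁻ˢ`, `s ≤ M`. -/
noncomputable def qHahnWeight (q : ℝ) (M : ℕ) (α β : ℝ) (s : ℕ) : ℝ :=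
  qpoch q (α * q) s * qpoch q (β * q) (M - s) /
    (qpoch q q s * qpoch q q (M - s) * (α * q) ^ s)

theorem qHahnWeight_pos {q : ℝ} (hq0 : 0 < q) (hq1 : q < 1) (M : ℕ) {α β : ℝ} (hα : 0 < α)
    (hα1 : α * q < 1) (hβ : 0 ≤ β) (hβ1 : β * q < 1) (s : ℕ) : 0 < qHahnWeight q M α β s := by
  have h1 := qpoch_pos hq0.le hq1.le (by positivity : 0 ≤ α * q) hα1 s
  have h2 := qpoch_pos hq0.le hq1.le (by positivity : 0 ≤ β * q) hβ1 (M - s)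
  have h3 := qpoch_pos hq0.le hq1.le hq0.le hq1 s
  have h4 := qpoch_pos hq0.le hq1.le hq0.le hq1 (M - s)
  unfold qHahnWeight
  positivity

theorem qHahnWeight_succ {q : ℝ} (hq0 : 0 < q) (hq1 : q < 1) {M : ℕ} {α : ℝ} (hα : 0 < α)
    (β : ℝ) {s : ℕ} (hs : s < M) :
    qHahnWeight q M α β (s + 1) * (α * q * (1 - q * q ^ s) * (1 - β * q * q ^ (M - (s + 1)))) =
      qHahnWeight q M α β s * ((1 - α * q * q ^ s) * (1 - q * q ^ (M - (s + 1)))) := by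
  obtain ⟨d, rfl⟩ : ∃ d, M = s + 1 + d := ⟨M - (s + 1), by omega⟩
  have e1 : s + 1 + d - s = d + 1 := by omega
  have e2 : s + 1 + d - (s + 1) = d := by omega
  have b1 := (qpoch_pos hq0.le hq1.le hq0.le hq1 s).ne'
  have b2 := (qpoch_pos hq0.le hq1.le hq0.le hq1 (s + 1)).ne'
  have c1 := (qpoch_pos hq0.le hq1.le hq0.le hq1 d).ne'
  have c2 := (qpoch_pos hq0.le hq1.le hq0.le hq1 (d + 1)).ne'
  rw [qpoch_succ] at b2 c2
  replace b2 := right_ne_zero_of_mul b2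
  replace c2 := right_ne_zero_of_mul c2
  simp only [qHahnWeight, e1, e2, qpoch_succ, pow_succ]
  have hq := hq0.ne'
  field_simp

/-- Summation by parts: `qHahnOp` is symmetric for the `q`-Hahn weight. -/
theorem sum_qHahnWeight_mul_qHahnOp {q : ℝ} (hq0 : 0 < q) (hq1 : q < 1) (M : ℕ) {α : ℝ}
    (hα : 0 < α) (β : ℝ) (F G : ℝ → ℝ) :
    ∑ s ∈ Finset.range (M + 1), qHahnWeight q M α β s *
        (qHahnOp q M α β F (q⁻¹ ^ s) * G (q⁻¹ ^ s)) =
      -∑ s ∈ Finset.range M, qHahnWeight q M α β s * ((1 - q ^ (-(M : ℤ)) / q⁻¹ ^ s) *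
        (1 - α * q / q⁻¹ ^ s)) * ((F (q⁻¹ ^ (s + 1)) - F (q⁻¹ ^ s)) *
          (G (q⁻¹ ^ (s + 1)) - G (q⁻¹ ^ s))) := by
  have hq := hq0.ne'
  have key : ∀ m ≤ M, ∑ s ∈ Finset.range (m + 1), qHahnWeight q M α β s *
        (qHahnOp q M α β F (q⁻¹ ^ s) * G (q⁻¹ ^ s)) =
      qHahnWeight q M α β m * ((1 - q ^ (-(M : ℤ)) / q⁻¹ ^ m) * (1 - α * q / q⁻¹ ^ m)) *
        ((F (q⁻¹ ^ (m + 1)) - F (q⁻¹ ^ m)) * G (q⁻¹ ^ m)) -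
      ∑ s ∈ Finset.range m, qHahnWeight q M α β s * ((1 - q ^ (-(M : ℤ)) / q⁻¹ ^ s) *
        (1 - α * q / q⁻¹ ^ s)) * ((F (q⁻¹ ^ (s + 1)) - F (q⁻¹ ^ s)) *
          (G (q⁻¹ ^ (s + 1)) - G (q⁻¹ ^ s))) := by
    intro m
    induction m with
    | zero =>
      intro _
      simp [qHahnOp]
      ring
    | succ m ih =>
      intro hm
      rw [Finset.sum_range_succ, ih (by omega), Finset.sum_range_succ _ m]
      have hback : q * q⁻¹ ^ (m + 1) = q⁻¹ ^ m := by rw [pow_succ']; field_simp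
      have hfwd : q⁻¹ * q⁻¹ ^ (m + 1) = q⁻¹ ^ (m + 1 + 1) := (pow_succ' _ _).symm
      have hbal : qHahnWeight q M α β (m + 1) * (α * q * (1 - 1 / q⁻¹ ^ (m + 1)) *
          (β - q ^ (-(M : ℤ)) / q⁻¹ ^ m)) = qHahnWeight q M α β m *
          ((1 - q ^ (-(M : ℤ)) / q⁻¹ ^ m) * (1 - α * q / q⁻¹ ^ m)) := by
        have h := qHahnWeight_succ hq0 hq1 hα β hm
        obtain ⟨d, rfl⟩ : ∃ d, M = m + 1 + d := ⟨M - (m + 1), by omega⟩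
        have e2 : m + 1 + d - (m + 1) = d := by omega
        rw [e2] at h
        have hK : q ^ (-((m + 1 + d : ℕ) : ℤ)) / q⁻¹ ^ m = 1 / (q * q ^ d) := by
          rw [zpow_neg, zpow_natCast, pow_add, pow_succ, inv_pow]
          field_simp
        have hm1 : α * q / q⁻¹ ^ m = α * q * q ^ m := by rw [inv_pow]; field_simp
        have hm2 : 1 / q⁻¹ ^ (m + 1) = q * q ^ m := by rw [inv_pow, pow_succ]; field_simp
        rw [hK, hm1, hm2]
        have hd : q ^ d ≠ 0 := pow_ne_zero d hq
        field_simp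
        linear_combination -h
      simp only [qHahnOp, hback, hfwd]
      linear_combination
        (-(F (q⁻¹ ^ (m + 1)) - F (q⁻¹ ^ m)) * G (q⁻¹ ^ (m + 1))) * hbal
  rw [key M le_rfl]
  have : (1 : ℝ) - q ^ (-(M : ℤ)) / q⁻¹ ^ M = 0 := by
    rw [zpow_neg, zpow_natCast, inv_pow, div_self (inv_ne_zero (pow_ne_zero M hq)), sub_self]
  rw [this]
  ring

theorem qHahnEigenvalue_ne {q : ℝ} (hq0 : 0 < q) (hq1 : q < 1) {α β : ℝ} (hα : 0 < α)
    (hα1 : α * q < 1) (hβ : 0 < β) (hβ1 : β * q < 1) {k n : ℕ} (hkn : k < n) :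
    qHahnEigenvalue q α β k ≠ qHahnEigenvalue q α β n := by
  have hqk := pow_pos hq0 k
  have hqn := pow_pos hq0 n
  have hlt : q ^ n < q ^ k := pow_lt_pow_right_of_lt_one₀ hq0 hq1 hkn
  have hn1 : q ^ n ≤ q := by simpa using pow_le_pow_of_le_one hq0.le hq1.le (by omega : 1 ≤ n)
  have hk1 : q ^ k ≤ 1 := pow_le_one₀ hq0.le hq1.le
  have hprod : (α * q) * (β * q) < 1 := mul_lt_one_of_nonneg_of_lt_one_left (by positivity) hα1
    hβ1.le
  have hsmall : α * β * q * q ^ n * q ^ k < 1 := by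
    calc α * β * q * q ^ n * q ^ k ≤ α * β * q * q * 1 := by gcongr
      _ = (α * q) * (β * q) := by ring
      _ < 1 := hprod
  have hdiff : qHahnEigenvalue q α β k - qHahnEigenvalue q α β n =
      -((q ^ k - q ^ n) * (1 - α * β * q * q ^ n * q ^ k) / (q ^ k * q ^ n)) := by
    unfold qHahnEigenvalue
    field_simp
    ring
  refine fun h => ?_
  have : 0 < (q ^ k - q ^ n) * (1 - α * β * q * q ^ n * q ^ k) / (q ^ k * q ^ n) := by
    have := sub_pos.2 hlt
    have := sub_pos.2 hsmall
    positivity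
  linarith [sub_eq_zero.2 h]

/-- `(X;q)_k` as a polynomial. -/
noncomputable def qpochPolynomial (q : ℝ) (k : ℕ) : ℝ[X] :=
  ∏ j ∈ Finset.range k, (C (-q ^ j) * X + C 1)

theorem eval_qpochPolynomial (q : ℝ) (k : ℕ) (t : ℝ) :
    (qpochPolynomial q k).eval t = qpoch q t k := by
  simp only [qpochPolynomial, qpoch, eval_prod, eval_add, eval_mul, eval_C, eval_X]
  exact Finset.prod_congr rfl fun j _ => by ring

theorem degree_qpochPolynomial {q : ℝ} (hq : q ≠ 0) (k : ℕ) : (qpochPolynomial q k).degree = k := by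
  rw [qpochPolynomial, degree_prod, Finset.sum_congr rfl fun j _ =>
    degree_linear (neg_ne_zero.2 (pow_ne_zero j hq))]
  simp

theorem X_mul_qpochPolynomial {q : ℝ} (hq : q ≠ 0) (k : ℕ) :
    X * qpochPolynomial q k =
      (q ^ k)⁻¹ • qpochPolynomial q k - (q ^ k)⁻¹ • qpochPolynomial q (k + 1) := by
  have hk : (C (q ^ k)⁻¹ * C (q ^ k) : ℝ[X]) = 1 := by
    rw [← C_mul, inv_mul_cancel₀ (pow_ne_zero k hq), C_1]
  have hsucc : qpochPolynomial q (k + 1) = qpochPolynomial q k * (-C (q ^ k) * X + 1) := by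
    rw [← C_neg, ← C_1]
    exact Finset.prod_range_succ _ _
  rw [smul_eq_C_mul, smul_eq_C_mul, hsucc]
  linear_combination (-X * qpochPolynomial q k) * hk

/-- The `q`-Hahn polynomial on `M + 1` nodes as a polynomial. -/
noncomputable def qHahnPolynomial (q : ℝ) (M n : ℕ) (α β : ℝ) : ℝ[X] :=
  ∑ k ∈ Finset.range (n + 1), qHahnCoeff q M n α β k • qpochPolynomial q k

theorem eval_qHahnPolynomial (q : ℝ) (M n : ℕ) (α β t : ℝ) :
    (qHahnPolynomial q M n α β).eval t = qHahnPoly q (M + 1) n α β t := by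
  simp [qHahnPolynomial, qHahnPoly_eq_sum, eval_finsetSum, eval_qpochPolynomial]

theorem qHahnCoeff_self_ne_zero {q : ℝ} (hq0 : 0 < q) (hq1 : q < 1) {M n : ℕ} (hn : 1 ≤ n)
    (hnM : n ≤ M) {α β : ℝ} (hα : 0 < α) (hα1 : α * q < 1) (hβ : 0 < β) (hβ1 : β * q < 1) :
    qHahnCoeff q M n α β n ≠ 0 := by
  have hprod : α * β * q ^ (n + 1) < 1 := by
    calc α * β * q ^ (n + 1) ≤ α * β * q ^ 2 := by
          gcongr _ * ?_
          exact pow_le_pow_of_le_one hq0.le hq1.le (by omega)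
      _ = (α * q) * (β * q) := by ring
      _ < 1 := mul_lt_one_of_nonneg_of_lt_one_left (by positivity) hα1 hβ1.le
  have h1 := qpoch_zpow_neg_ne_zero hq0 hq1 (le_refl n)
  have h2 := (qpoch_pos hq0.le hq1.le (by positivity) hprod n).ne'
  have h3 := (qpoch_pos hq0.le hq1.le (by positivity : 0 ≤ α * q) hα1 n).ne'
  have h4 := qpoch_zpow_neg_ne_zero hq0 hq1 hnM
  have h5 := (qpoch_pos hq0.le hq1.le hq0.le hq1 n).ne'
  have h6 := pow_ne_zero n hq0.ne'
  unfold qHahnCoeff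
  positivity

theorem degree_qHahnPolynomial {q : ℝ} (hq0 : 0 < q) (hq1 : q < 1) {M n : ℕ} (hn : 1 ≤ n)
    (hnM : n ≤ M) {α β : ℝ} (hα : 0 < α) (hα1 : α * q < 1) (hβ : 0 < β) (hβ1 : β * q < 1) :
    (qHahnPolynomial q M n α β).degree = n := by
  have htop : (qHahnCoeff q M n α β n • qpochPolynomial q n).degree = n := by
    rw [smul_eq_C_mul, degree_C_mul (qHahnCoeff_self_ne_zero hq0 hq1 hn hnM hα hα1 hβ hβ1),
      degree_qpochPolynomial hq0.ne']
  rw [qHahnPolynomial, Finset.sum_range_succ, degree_add_eq_right_of_degree_lt, htop]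
  rw [htop]
  refine (degree_sum_le _ _).trans_lt ((Finset.sup_lt_iff (WithBot.bot_lt_coe n)).2 fun k hk => ?_)
  refine (degree_smul_le _ _).trans_lt ?_
  rw [degree_qpochPolynomial hq0.ne']
  exact Nat.cast_lt.2 (Finset.mem_range.1 hk)

theorem discreteIntegral_qHahnPolynomial_mul_qpochPolynomial {q : ℝ} (hq0 : 0 < q) (hq1 : q < 1)
    {M n : ℕ} (hnM : n ≤ M) {α β : ℝ} (hα : 0 < α) (hα1 : α * q < 1) (hβ : 0 < β)
    (hβ1 : β * q < 1) {k : ℕ} (hk : k < n) :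
    discreteIntegral (Finset.range (M + 1)) (fun s => q⁻¹ ^ s) (qHahnWeight q M α β)
      (qHahnPolynomial q M n α β * qpochPolynomial q k) = 0 := by
  have hx : ∀ s : ℕ, q⁻¹ ^ s ≠ 0 := fun s => pow_ne_zero s (inv_ne_zero hq0.ne')
  have hsymm : ∀ k, ∑ s ∈ Finset.range (M + 1), qHahnWeight q M α β s *
      (qHahnEigenvalue q α β n * qHahnPoly q (M + 1) n α β (q⁻¹ ^ s) * qpoch q (q⁻¹ ^ s) k) =
      ∑ s ∈ Finset.range (M + 1), qHahnWeight q M α β s *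
      (qHahnOp q M α β (fun t => qpoch q t k) (q⁻¹ ^ s) *
        qHahnPoly q (M + 1) n α β (q⁻¹ ^ s)) := by
    intro k
    rw [sum_qHahnWeight_mul_qHahnOp hq0 hq1 M hα β (fun t => qpoch q t k)]
    simp only [← qHahnOp_qHahnPoly hq0 hq1 hnM hα.le hα1 β (hx _)]
    rw [sum_qHahnWeight_mul_qHahnOp hq0 hq1 M hα β _ (fun t => qpoch q t k)]
    congr 1
    exact Finset.sum_congr rfl fun s _ => by ring
  simp only [discreteIntegral_apply, eval_mul, eval_qHahnPolynomial, eval_qpochPolynomial]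
  have hne := qHahnEigenvalue_ne hq0 hq1 hα hα1 hβ hβ1 hk
  refine (mul_eq_zero.1 ?_).resolve_left (sub_ne_zero.2 hne.symm)
  induction k with
  | zero =>
    have h := hsymm 0
    simp only [qHahnOp_qpoch_zero, zero_mul, mul_zero, Finset.sum_const_zero] at h
    have h0 : qHahnEigenvalue q α β 0 = 0 := by simp [qHahnEigenvalue]
    rw [h0, sub_zero, Finset.mul_sum, ← h]
    exact Finset.sum_congr rfl fun s _ => by ring
  | succ k ih =>
    have hne' := qHahnEigenvalue_ne hq0 hq1 hα hα1 hβ hβ1 (k.lt_succ_self.trans hk)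
    have ih' := (mul_eq_zero.1 (ih (k.lt_succ_self.trans hk) hne')).resolve_left
      (sub_ne_zero.2 hne'.symm)
    have h := hsymm (k + 1)
    simp only [qHahnOp_qpoch_succ hq0.ne' M α β (hx _)] at h
    set μ := (1 - q * q ^ k) * (1 - q ^ (-(M : ℤ)) * q ^ k) * (1 - α * q * q ^ k) / (q * q ^ k)
    calc _ = ∑ s ∈ Finset.range (M + 1), qHahnWeight q M α β s *
          (qHahnEigenvalue q α β n * qHahnPoly q (M + 1) n α β (q⁻¹ ^ s) *
            qpoch q (q⁻¹ ^ s) (k + 1)) -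
          ∑ s ∈ Finset.range (M + 1), qHahnWeight q M α β s *
          ((qHahnEigenvalue q α β (k + 1) * qpoch q (q⁻¹ ^ s) (k + 1) - μ * qpoch q (q⁻¹ ^ s) k) *
            qHahnPoly q (M + 1) n α β (q⁻¹ ^ s)) -
          μ * ∑ s ∈ Finset.range (M + 1), qHahnWeight q M α β s *
            (qHahnPoly q (M + 1) n α β (q⁻¹ ^ s) * qpoch q (q⁻¹ ^ s) k) := by
          rw [Finset.mul_sum, Finset.mul_sum, ← Finset.sum_sub_distrib, ← Finset.sum_sub_distrib]
          exact Finset.sum_congr rfl fun s _ => by ring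
      _ = 0 := by rw [h, ih', sub_self, mul_zero, sub_zero]

theorem isOrthogonalPoly_qHahnPolynomial {q : ℝ} (hq0 : 0 < q) (hq1 : q < 1) {M n : ℕ}
    (hn : 1 ≤ n) (hnM : n ≤ M) {α β : ℝ} (hα : 0 < α) (hα1 : α * q < 1) (hβ : 0 < β)
    (hβ1 : β * q < 1) :
    IsOrthogonalPoly (Finset.range (M + 1)) (fun s => q⁻¹ ^ s) (qHahnWeight q M α β) n
      (qHahnPolynomial q M n α β) := by
  refine ⟨degree_qHahnPolynomial hq0 hq1 hn hnM hα hα1 hβ hβ1, fun f hf => ?_⟩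
  have hX : ∀ m k, m + k < n →
      discreteIntegral (Finset.range (M + 1)) (fun s => q⁻¹ ^ s) (qHahnWeight q M α β)
        (qHahnPolynomial q M n α β * (X ^ m * qpochPolynomial q k)) = 0 := by
    intro m
    induction m with
    | zero =>
      intro k hk
      rw [pow_zero, one_mul]
      exact discreteIntegral_qHahnPolynomial_mul_qpochPolynomial hq0 hq1 hnM hα hα1 hβ hβ1
        (by omega)
    | succ m ih =>
      intro k hk
      rw [pow_succ, mul_assoc, X_mul_qpochPolynomial hq0.ne']
      simp only [mul_sub, mul_smul_comm, map_sub, map_smul]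
      rw [ih k (by omega), ih (k + 1) (by omega)]
      simp
  have hXm : ∀ m < n,
      discreteIntegral (Finset.range (M + 1)) (fun s => q⁻¹ ^ s) (qHahnWeight q M α β)
        (qHahnPolynomial q M n α β * X ^ m) = 0 := by
    intro m hm
    simpa [qpochPolynomial] using hX m 0 hm
  have hfn : f.natDegree < n := by
    rcases eq_or_ne f 0 with rfl | h0
    · rw [natDegree_zero]
      omega
    · exact (natDegree_lt_iff_degree_lt h0).2 hf
  rw [as_sum_range' f n hfn, Finset.mul_sum, map_sum]
  refine Finset.sum_eq_zero fun m hm => ?_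
  rw [← C_mul_X_pow_eq_monomial, ← smul_eq_C_mul, mul_smul_comm, map_smul,
    hXm m (Finset.mem_range.1 hm), smul_zero]

theorem mul_lt_mul_of_ratio_succ_lt {M : ℕ} {v w ρ σ : ℕ → ℝ} (hv : ∀ s, 0 < v s)
    (hw : ∀ s, 0 < w s) (hρ : ∀ s < M, v (s + 1) = v s * ρ s)
    (hσ : ∀ s < M, w (s + 1) = w s * σ s) (h : ∀ s < M, ρ s < σ s) :
    ∀ s ∈ Finset.range (M + 1), ∀ t ∈ Finset.range (M + 1), s < t → w s * v t < w t * v s := by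
  have hmono : StrictMonoOn (fun s => w s / v s) (Set.Iic M) := by
    refine strictMonoOn_of_lt_succ Set.ordConnected_Iic fun s _ _ hs => ?_
    replace hs : s < M := hs
    have hvs : 0 < v s * ρ s := hρ s hs ▸ hv (s + 1)
    rw [Nat.succ_eq_succ, Nat.succ_eq_add_one, hρ s hs, hσ s hs, div_lt_div_iff₀ (hv s) hvs]
    have := mul_lt_mul_of_pos_left (h s hs) (mul_pos (hw s) (hv s))
    linarith
  intro s hs t ht hst
  have := hmono (Set.mem_Iic.2 (by simpa [Nat.lt_succ_iff] using hs))
    (Set.mem_Iic.2 (by simpa [Nat.lt_succ_iff] using ht)) hst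
  exact (div_lt_div_iff₀ (hv s) (hv t)).1 this

theorem qHahnWeight_succ_eq {q : ℝ} (hq0 : 0 < q) (hq1 : q < 1) {M : ℕ} {α : ℝ} (hα : 0 < α)
    {β : ℝ} (hβ : 0 ≤ β) (hβ1 : β * q < 1) {s : ℕ} (hs : s < M) :
    qHahnWeight q M α β (s + 1) = qHahnWeight q M α β s *
      ((1 - α * q * q ^ s) * (1 - q * q ^ (M - (s + 1))) /
        (α * q * (1 - q * q ^ s) * (1 - β * q * q ^ (M - (s + 1))))) := by
  have h1 := sub_pos.2 (mul_lt_one_of_nonneg_of_lt_one_left hq0.le hq1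
    (pow_le_one₀ hq0.le hq1.le (n := s)))
  have h2 := sub_pos.2 (mul_lt_one_of_nonneg_of_lt_one_left (by positivity) hβ1
    (pow_le_one₀ hq0.le hq1.le (n := M - (s + 1))))
  rw [← mul_div_assoc, eq_div_iff (by positivity), qHahnWeight_succ hq0 hq1 hα β hs]

theorem qHahnWeight_ratio_lt_of_lt_left {q : ℝ} (hq0 : 0 < q) (hq1 : q < 1) (M : ℕ)
    {α₁ α₂ β : ℝ} (hα₁ : 0 < α₁) (h : α₁ < α₂) (hα₂ : α₂ * q < 1) (hβ : 0 ≤ β)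
    (hβ1 : β * q < 1) :
    ∀ s ∈ Finset.range (M + 1), ∀ t ∈ Finset.range (M + 1), s < t →
      qHahnWeight q M α₁ β s * qHahnWeight q M α₂ β t <
        qHahnWeight q M α₁ β t * qHahnWeight q M α₂ β s := by
  have hα₁q : α₁ * q < 1 := (mul_lt_mul_of_pos_right h hq0).trans hα₂
  have hα₂0 := hα₁.trans h
  refine mul_lt_mul_of_ratio_succ_lt (qHahnWeight_pos hq0 hq1 M hα₂0 hα₂ hβ hβ1)
    (qHahnWeight_pos hq0 hq1 M hα₁ hα₁q hβ hβ1)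
    (fun s hs => qHahnWeight_succ_eq hq0 hq1 hα₂0 hβ hβ1 hs)
    (fun s hs => qHahnWeight_succ_eq hq0 hq1 hα₁ hβ hβ1 hs) fun s _ => ?_
  have h1 := sub_pos.2 (mul_lt_one_of_nonneg_of_lt_one_left hq0.le hq1
    (pow_le_one₀ hq0.le hq1.le (n := s)))
  have h2 := sub_pos.2 (mul_lt_one_of_nonneg_of_lt_one_left (by positivity) hβ1
    (pow_le_one₀ hq0.le hq1.le (n := M - (s + 1))))
  have h3 := sub_pos.2 (mul_lt_one_of_nonneg_of_lt_one_left hq0.le hq1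
    (pow_le_one₀ hq0.le hq1.le (n := M - (s + 1))))
  generalize 1 - q * q ^ (M - (s + 1)) = u at *
  generalize 1 - β * q * q ^ (M - (s + 1)) = v at *
  rw [div_lt_div_iff₀ (by positivity) (by positivity)]
  have := mul_lt_mul_of_pos_right h (by positivity : 0 < u * q * (1 - q * q ^ s) * v)
  linarith

theorem qHahnWeight_ratio_lt_of_lt_right {q : ℝ} (hq0 : 0 < q) (hq1 : q < 1) (M : ℕ)
    {α β₁ β₂ : ℝ} (hα : 0 < α) (hα1 : α * q < 1) (hβ₁ : 0 < β₁) (h : β₁ < β₂)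
    (hβ₂ : β₂ * q < 1) :
    ∀ s ∈ Finset.range (M + 1), ∀ t ∈ Finset.range (M + 1), s < t →
      qHahnWeight q M α β₂ s * qHahnWeight q M α β₁ t <
        qHahnWeight q M α β₂ t * qHahnWeight q M α β₁ s := by
  have hβ₁q : β₁ * q < 1 := (mul_lt_mul_of_pos_right h hq0).trans hβ₂
  have hβ₂0 := hβ₁.trans h
  refine mul_lt_mul_of_ratio_succ_lt (qHahnWeight_pos hq0 hq1 M hα hα1 hβ₁.le hβ₁q)
    (qHahnWeight_pos hq0 hq1 M hα hα1 hβ₂0.le hβ₂)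
    (fun s hs => qHahnWeight_succ_eq hq0 hq1 hα hβ₁.le hβ₁q hs)
    (fun s hs => qHahnWeight_succ_eq hq0 hq1 hα hβ₂0.le hβ₂ hs) fun s _ => ?_
  have h1 := sub_pos.2 (mul_lt_one_of_nonneg_of_lt_one_left hq0.le hq1
    (pow_le_one₀ hq0.le hq1.le (n := s)))
  have h2 := sub_pos.2 (mul_lt_one_of_nonneg_of_lt_one_left (by positivity) hβ₂
    (pow_le_one₀ hq0.le hq1.le (n := M - (s + 1))))
  have h3 := sub_pos.2 (mul_lt_one_of_nonneg_of_lt_one_left hq0.le hq1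
    (pow_le_one₀ hq0.le hq1.le (n := M - (s + 1))))
  have h4 := sub_pos.2 (mul_lt_one_of_nonneg_of_lt_one_left (by positivity) hα1
    (pow_le_one₀ hq0.le hq1.le (n := s)))
  gcongr

/-- zeros of q-Hahn polynomials: monotonicity in `α` and `β`. -/
theorem stmt_10 (q : ℝ) (hq0 : 0 < q) (hq1 : q < 1) (N n : ℕ) (hN : 2 ≤ N) (hn : 1 ≤ n)
    (hnN : n ≤ N - 1) :
    ∃ x : ℝ → ℝ → Fin n → ℝ,
      (∀ α β : ℝ, 0 < α → α < q⁻¹ → 0 < β → β < q⁻¹ →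
        StrictMono (x α β) ∧
        (∀ j, qHahnPoly q N n α β (x α β j) = 0) ∧
        (∀ y : ℝ, qHahnPoly q N n α β y = 0 → ∃ j, y = x α β j)) ∧
      (∀ β : ℝ, 0 < β → β < q⁻¹ →
        ∀ j, StrictAntiOn (fun α => x α β j) (Set.Ioo 0 q⁻¹)) ∧
      (∀ α : ℝ, 0 < α → α < q⁻¹ →
        ∀ j, StrictMonoOn (fun β => x α β j) (Set.Ioo 0 q⁻¹)) := by
  obtain ⟨M, rfl⟩ : ∃ M, N = M + 1 := ⟨N - 1, by omega⟩
  have hnM : n ≤ M := by omega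
  have hmul : ∀ {a : ℝ}, a < q⁻¹ → a * q < 1 := fun h => (lt_inv_mul_iff₀' hq0).1 (by simpa using h)
  have hy : StrictMonoOn (fun s : ℕ => q⁻¹ ^ s) (Finset.range (M + 1)) :=
    (pow_right_strictMono₀ ((one_lt_inv₀ hq0).2 hq1)).strictMonoOn _
  have hcard : n < (Finset.range (M + 1)).card := by rw [Finset.card_range]; omega
  have hex : ∀ α β : ℝ, ∃ x : Fin n → ℝ, 0 < α → α < q⁻¹ → 0 < β → β < q⁻¹ →
      StrictMono x ∧ (∀ t, qHahnPoly q (M + 1) n α β t = 0 ↔ ∃ j, t = x j) ∧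
      IsOrthogonalPoly (Finset.range (M + 1)) (fun s => q⁻¹ ^ s) (qHahnWeight q M α β) n
        (Lagrange.nodal Finset.univ x) := by
    intro α β
    by_cases h : 0 < α ∧ α < q⁻¹ ∧ 0 < β ∧ β < q⁻¹
    · obtain ⟨hα, hα1, hβ, hβ1⟩ := h
      have horth := isOrthogonalPoly_qHahnPolynomial hq0 hq1 hn hnM hα (hmul hα1) hβ (hmul hβ1)
      obtain ⟨x, hx, hroot, hxp⟩ := horth.exists_strictMono_nodal hy.injOn
        (fun s _ => qHahnWeight_pos hq0 hq1 M hα (hmul hα1) hβ.le (hmul hβ1) s) hcard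
      exact ⟨x, fun _ _ _ _ => ⟨hx, by simpa only [eval_qHahnPolynomial] using hroot,
        horth.nodal hxp⟩⟩
    · exact ⟨0, fun h1 h2 h3 h4 => absurd ⟨h1, h2, h3, h4⟩ h⟩
  choose x hx using hex
  refine ⟨x, fun α β h1 h2 h3 h4 => ?_, fun β hβ hβ1 j α₁ hα₁ α₂ hα₂ h => ?_,
    fun α hα hα1 j β₁ hβ₁ β₂ hβ₂ h => ?_⟩
  · obtain ⟨hmono, hroot, -⟩ := hx α β h1 h2 h3 h4
    exact ⟨hmono, fun j => (hroot _).2 ⟨j, rfl⟩, fun t => (hroot t).1⟩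
  · obtain ⟨hm₁, -, ho₁⟩ := hx α₁ β hα₁.1 hα₁.2 hβ hβ1
    obtain ⟨hm₂, -, ho₂⟩ := hx α₂ β hα₂.1 hα₂.2 hβ hβ1
    exact ho₂.zero_lt_zero hm₂ hm₁ ho₁ hy hcard
      (fun s _ => qHahnWeight_pos hq0 hq1 M hα₂.1 (hmul hα₂.2) hβ.le (hmul hβ1) s)
      (fun s _ => qHahnWeight_pos hq0 hq1 M hα₁.1 (hmul hα₁.2) hβ.le (hmul hβ1) s)
      (qHahnWeight_ratio_lt_of_lt_left hq0 hq1 M hα₁.1 h (hmul hα₂.2) hβ.le (hmul hβ1)) j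
  · obtain ⟨hm₁, -, ho₁⟩ := hx α β₁ hα hα1 hβ₁.1 hβ₁.2
    obtain ⟨hm₂, -, ho₂⟩ := hx α β₂ hα hα1 hβ₂.1 hβ₂.2
    exact ho₁.zero_lt_zero hm₁ hm₂ ho₂ hy hcard
      (fun s _ => qHahnWeight_pos hq0 hq1 M hα (hmul hα1) hβ₁.1.le (hmul hβ₁.2) s)
      (fun s _ => qHahnWeight_pos hq0 hq1 M hα (hmul hα1) hβ₂.1.le (hmul hβ₂.2) s)
      (qHahnWeight_ratio_lt_of_lt_right hq0 hq1 M hα (hmul hα1) hβ₁.1 h (hmul hβ₂.2)) j
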